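/- arXiv:1306.3252 — 11 statements merged into one kernel-verified Lean document; each statement's English description precedes it below -/
import Mathlib

section
/- For every z ∈ ℝⁿ with V(z) ≥ b and ∇V(z) ≠ 0, every w ∈ ℝᵏ and every u ∈ U, the correction-term observer vector field satisfies ∇V(z)·( f(z,u) + k̂(z,w,u) ) ≤ −W(z). -/
open scoped RealInnerProductSpace

/-- Inequality (3.1): for every `z` with `V(z) ≥ b` (and nonvanishing gradient), every
`w ∈ ℝᵏ` and every `u ∈ U`, the correction-term observer vector field satisfies
`∇V(z)·( f(z,u) + k̂(z,w,u) ) ≤ −W(z)`. -/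
theorem stmt3 {n m kd : ℕ}
    (U : Set (EuclideanSpace ℝ (Fin m))) (hUc : IsCompact U) (hUne : U.Nonempty)
    (f : EuclideanSpace ℝ (Fin n) → EuclideanSpace ℝ (Fin m) → EuclideanSpace ℝ (Fin n))
    (hf : ContDiff ℝ (⊤ : ℕ∞) (Function.uncurry f))
    (h : EuclideanSpace ℝ (Fin n) → EuclideanSpace ℝ (Fin kd))
    (hh : ContDiff ℝ (⊤ : ℕ∞) h)
    (V W : EuclideanSpace ℝ (Fin n) → ℝ)
    (hV : ContDiff ℝ 2 V) (hVnn : ∀ x, 0 ≤ V x)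
    (hVrad : ∀ M : ℝ, Bornology.IsBounded {x | V x ≤ M})
    (hW : ContDiff ℝ 1 W) (hW0 : W 0 = 0) (hWpos : ∀ x, x ≠ 0 → 0 < W x)
    (R a b : ℝ) (hR : 0 < R) (haR : R ≤ a) (hab : a < b)
    (L : EuclideanSpace ℝ (Fin kd) →L[ℝ] EuclideanSpace ℝ (Fin n))
    (p : ℝ → ℝ) (hp_lip : LocallyLipschitz p) (hp01 : ∀ s, p s ∈ Set.Icc (0:ℝ) 1)
    (hpb : ∀ s, b ≤ s → p s = 1) (hpa : ∀ s, s ≤ a → p s = 0)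
    (φ : EuclideanSpace ℝ (Fin n) → EuclideanSpace ℝ (Fin kd) → EuclideanSpace ℝ (Fin m) → ℝ)
    (hφ : ∀ z y u, φ z y u =
      max 0 (⟪gradient V z, f z u⟫ + W z + p (V z) * ⟪gradient V z, L (h z - y)⟫))
    (khat : EuclideanSpace ℝ (Fin n) → EuclideanSpace ℝ (Fin kd) →
      EuclideanSpace ℝ (Fin m) → EuclideanSpace ℝ (Fin n))
    (hkhat : ∀ z y u, khat z y u =
      if V z ≤ R then L (h z - y)
      else L (h z - y) - (φ z y u / ‖gradient V z‖ ^ 2) • gradient V z) :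
    ∀ z : EuclideanSpace ℝ (Fin n), b ≤ V z → gradient V z ≠ 0 →
      ∀ w : EuclideanSpace ℝ (Fin kd), ∀ u ∈ U,
        ⟪gradient V z, f z u + khat z w u⟫ ≤ -W z := by
  intro z hz hg w u _
  have hne : ‖gradient V z‖ ^ 2 ≠ 0 := pow_ne_zero 2 (norm_ne_zero_iff.mpr hg)
  have hφ_ge := le_max_right 0
    (⟪gradient V z, f z u⟫ + W z + p (V z) * ⟪gradient V z, L (h z - w)⟫)
  rw [← hφ z w u, hpb _ hz, one_mul] at hφ_ge
  rw [hkhat, if_neg (by linarith), inner_add_right, inner_sub_right, real_inner_smul_right,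
    real_inner_self_eq_norm_sq, div_mul_cancel₀ _ hne]
  linarith
end

section
/- Assume (H1), (H3) and (H4), and assume ∇V(z) ≠ 0 for every z with V(z) > R. Then for all x with V(x) ≤ R, all z with V(z) ≤ b, and all u ∈ U: (z−x)ᵀ Q ( f(z,u) + k̂(z, h(x), u) − f(x,u) ) ≤ −cω|z−x|². -/
open scoped RealInnerProductSpace

/-- Inequality (3.17): under (H1), (H3), (H4) (and nonvanishing gradient of `V` where
`V > R`), the correction-term observer vector field satisfies
`(z−x)ᵀQ( f(z,u) + k̂(z,h(x),u) − f(x,u) ) ≤ −cω|z−x|²` for all `x` with `V(x) ≤ R`,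
`z` with `V(z) ≤ b` and `u ∈ U`. -/
theorem stmt4 {n m kd : ℕ}
    (U : Set (EuclideanSpace ℝ (Fin m))) (hUc : IsCompact U) (hUne : U.Nonempty)
    (f : EuclideanSpace ℝ (Fin n) → EuclideanSpace ℝ (Fin m) → EuclideanSpace ℝ (Fin n))
    (hf : ContDiff ℝ (⊤ : ℕ∞) (Function.uncurry f))
    (h : EuclideanSpace ℝ (Fin n) → EuclideanSpace ℝ (Fin kd))
    (hh : ContDiff ℝ (⊤ : ℕ∞) h)
    -- (H1)
    (V W : EuclideanSpace ℝ (Fin n) → ℝ)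
    (hV : ContDiff ℝ 2 V) (hVnn : ∀ x, 0 ≤ V x)
    (hVrad : ∀ M : ℝ, Bornology.IsBounded {x | V x ≤ M})
    (hW : ContDiff ℝ 1 W) (hW0 : W 0 = 0) (hWpos : ∀ x, x ≠ 0 → 0 < W x)
    (R : ℝ) (hR : 0 < R)
    (h1 : ∀ x, ∀ u ∈ U, R ≤ V x → ⟪gradient V x, f x u⟫ ≤ -W x)
    -- (H3)
    (Q : EuclideanSpace ℝ (Fin n) →L[ℝ] EuclideanSpace ℝ (Fin n))
    (hQsym : ∀ v w : EuclideanSpace ℝ (Fin n), ⟪Q v, w⟫ = ⟪v, Q w⟫)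
    (hQpos : ∀ v : EuclideanSpace ℝ (Fin n), v ≠ 0 → 0 < ⟪v, Q v⟫)
    (ω b : ℝ) (hω : 0 < ω) (hbR : R < b)
    (L : EuclideanSpace ℝ (Fin kd) →L[ℝ] EuclideanSpace ℝ (Fin n))
    (h3 : ∀ u ∈ U, ∀ z x : EuclideanSpace ℝ (Fin n), V z ≤ b → V x ≤ R →
      ⟪z - x, Q (f z u + L (h z - h x) - f x u)⟫ ≤ -ω * ‖z - x‖ ^ 2)
    -- (H4)
    (c a : ℝ) (hc : c ∈ Set.Ioo (0:ℝ) 1) (haR : R ≤ a) (hab : a < b)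
    (h4 : ∀ u ∈ U, ∀ z x : EuclideanSpace ℝ (Fin n),
      a < V z → V z ≤ b → V x ≤ R → ⟪gradient V z, Q (z - x)⟫ < 0 →
      ⟪gradient V z, f z u + L (h z - h x)⟫ ≤
        -W z + (1 - c) * ‖gradient V z‖ ^ 2 *
          ⟪z - x, Q (f z u + L (h z - h x) - f x u)⟫ / ⟪gradient V z, Q (z - x)⟫)
    -- nonvanishing gradient
    (hgrad : ∀ z : EuclideanSpace ℝ (Fin n), R < V z → gradient V z ≠ 0)
    -- the correction-term observer vector field
    (p : ℝ → ℝ) (hp_lip : LocallyLipschitz p) (hp01 : ∀ s, p s ∈ Set.Icc (0:ℝ) 1)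
    (hpb : ∀ s, b ≤ s → p s = 1) (hpa : ∀ s, s ≤ a → p s = 0)
    (khat : EuclideanSpace ℝ (Fin n) → EuclideanSpace ℝ (Fin kd) →
      EuclideanSpace ℝ (Fin m) → EuclideanSpace ℝ (Fin n))
    (hkhat : ∀ z y u, khat z y u =
      if V z ≤ R then L (h z - y)
      else L (h z - y) -
        ((max 0 (⟪gradient V z, f z u⟫ + W z + p (V z) * ⟪gradient V z, L (h z - y)⟫) /
            ‖gradient V z‖ ^ 2) • gradient V z)) :
    ∀ x : EuclideanSpace ℝ (Fin n), V x ≤ R →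
      ∀ z : EuclideanSpace ℝ (Fin n), V z ≤ b → ∀ u ∈ U,
        ⟪z - x, Q (f z u + khat z (h x) u - f x u)⟫ ≤ -(c * ω) * ‖z - x‖ ^ 2 := by
  intro x hx z hz u hu
  obtain ⟨hc0, hc1⟩ := hc
  have hA := h3 u hu z x hz hx
  have hAc : -ω * ‖z - x‖ ^ 2 ≤ -(c * ω) * ‖z - x‖ ^ 2 := by
    nlinarith [mul_nonneg (mul_nonneg (sub_nonneg.2 hc1.le) hω.le) (sq_nonneg ‖z - x‖)]
  rw [hkhat]
  split_ifs with hVR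
  · exact hA.trans hAc
  push Not at hVR
  set g := gradient V z with hg
  have hg2 : 0 < ‖g‖ ^ 2 := by
    have := norm_pos_iff.2 (hgrad z hVR)
    positivity
  set φ := max 0 (⟪g, f z u⟫ + W z + p (V z) * ⟪g, L (h z - h x)⟫) with hφ
  have hφ0 : 0 ≤ φ := le_max_left _ _
  have hsplit : ⟪z - x, Q (f z u + (L (h z - h x) - (φ / ‖g‖ ^ 2) • g) - f x u)⟫ =
      ⟪z - x, Q (f z u + L (h z - h x) - f x u)⟫ - φ / ‖g‖ ^ 2 * ⟪g, Q (z - x)⟫ := by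
    have hcomm : ⟪z - x, Q g⟫ = ⟪g, Q (z - x)⟫ := by
      rw [← hQsym, real_inner_comm]
    rw [← hcomm, ← real_inner_smul_right, ← inner_sub_right, ← map_smul, ← map_sub]
    congr 2
    abel
  rw [hsplit]
  set A := ⟪z - x, Q (f z u + L (h z - h x) - f x u)⟫ with hAdef
  set s := ⟪g, Q (z - x)⟫ with hs
  have hdiss := h1 z u hu hVR.le
  rw [← hg] at hdiss
  rcases le_or_gt 0 s with hs0 | hs0
  · have : 0 ≤ φ / ‖g‖ ^ 2 * s := by positivity
    linarith
  rcases le_or_gt (V z) a with hVa | hVa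
  · have hφz : φ = 0 := by
      rw [hφ, hpa _ hVa]
      exact max_eq_left (by linarith)
    rw [hφz, zero_div, zero_mul, sub_zero]
    exact hA.trans hAc
  have hA0 : A ≤ 0 := by nlinarith [mul_nonneg hω.le (sq_nonneg ‖z - x‖)]
  have hbound := h4 u hu z x hVa hz hx hs0
  rw [← hg, ← hAdef, ← hs, inner_add_right] at hbound
  set B := (1 - c) * ‖g‖ ^ 2 * A / s with hB
  have hB0 : 0 ≤ B :=
    div_nonneg_of_nonpos
      (mul_nonpos_of_nonneg_of_nonpos (mul_nonneg (sub_nonneg.2 hc1.le) hg2.le) hA0) hs0.le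
  obtain ⟨hp0, hp1⟩ := hp01 (V z)
  have hφB : φ ≤ B := by
    refine max_le hB0 ?_
    nlinarith [mul_nonneg (sub_nonneg.2 hp1) (by linarith : 0 ≤ -W z - ⟪g, f z u⟫),
      mul_nonneg hp0 (by linarith : 0 ≤ -W z + B - (⟪g, f z u⟫ + ⟪g, L (h z - h x)⟫)),
      mul_nonneg (sub_nonneg.2 hp1) hB0]
  have hcorr : (1 - c) * A ≤ φ / ‖g‖ ^ 2 * s := by
    have hBs : B / ‖g‖ ^ 2 * s = (1 - c) * A := by
      have hs_ne := hs0.ne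
      have hg_ne : ‖g‖ ≠ 0 := norm_ne_zero_iff.2 (hgrad z hVR)
      rw [hB]
      field_simp
    rw [← hBs]
    exact mul_le_mul_of_nonpos_right (div_le_div_of_nonneg_right hφB hg2.le) hs0.le
  nlinarith [mul_le_mul_of_nonneg_left hA hc0.le]
end

section
/- Suppose k : ℝⁿ → U is locally Lipschitz with k(0) = 0 and satisfies ∇P(x)·f(x,k(x)) ≤ −2μ|x|² for all x with V(x) ≤ R. Define k̃(x) := ( R+1 − min( R+1, max( R, V(x) ) ) )·k(x). Then k̃ is globally Lipschitz on ℝⁿ, k̃(0) = 0, k̃(x) = k(x) for every x with V(x) ≤ R, and consequently ∇P(x)·f(x, k̃(x)) ≤ −2μ|x|² for all x with V(x) ≤ R. -/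
open scoped RealInnerProductSpace

theorem LocallyLipschitz.exists_lipschitzWith_of_hasCompactSupport {α E : Type*}
    [PseudoMetricSpace α] [ProperSpace α] [NormedAddCommGroup E] {g : α → E}
    (hg : LocallyLipschitz g) (hs : HasCompactSupport g) : ∃ K, LipschitzWith K g := by
  obtain ⟨K, hK⟩ := hg.locallyLipschitzOn.exists_lipschitzOnWith_of_compact
    (hs.isCompact.cthickening (r := 1))
  obtain ⟨C, hC⟩ := hs.exists_bound_of_continuous hg.continuous
  have near : ∀ x y, x ∈ tsupport g → dist x y ≤ 1 → dist (g x) (g y) ≤ K * dist x y := by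
    intro x y hx hxy
    refine hK.dist_le_mul x (Metric.self_subset_cthickening _ hx) y ?_
    exact Metric.mem_cthickening_of_dist_le y x 1 _ hx (by rwa [dist_comm])
  refine ⟨K + (2 * C).toNNReal, LipschitzWith.of_dist_le_mul fun x y => ?_⟩
  have hmax : 2 * C ≤ ((2 * C).toNNReal : ℝ) := Real.le_coe_toNNReal _
  have hd : 0 ≤ dist x y := dist_nonneg
  have hKd : 0 ≤ (K : ℝ) * dist x y := by positivity
  have hCd : 0 ≤ ((2 * C).toNNReal : ℝ) * dist x y := by positivity
  rw [NNReal.coe_add, add_mul]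
  rcases le_total (dist x y) 1 with h | h
  · by_cases hx : x ∈ tsupport g
    · linarith [near x y hx h]
    by_cases hy : y ∈ tsupport g
    · have := near y x hy (by rwa [dist_comm])
      rw [dist_comm (g y), dist_comm y] at this
      linarith
    · rw [image_eq_zero_of_notMem_tsupport hx, image_eq_zero_of_notMem_tsupport hy, dist_self]
      linarith
  · have h1 : dist (g x) (g y) ≤ 2 * C := by
      linarith [dist_le_norm_add_norm (g x) (g y), hC x, hC y]
    have h2 := le_mul_of_one_le_right ((2 * C).toNNReal).coe_nonneg h
    linarith

theorem LocallyLipschitz.smul_of_real {α E : Type*} [PseudoEMetricSpace α]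
    [NormedAddCommGroup E] [NormedSpace ℝ E] {c : α → ℝ} {g : α → E}
    (hc : LocallyLipschitz c) (hg : LocallyLipschitz g) :
    LocallyLipschitz fun x => c x • g x :=
  (contDiff_smul (𝕜 := ℝ) (F := E) (n := 1)).locallyLipschitz.comp (hc.prodMk hg)

/-- If `k : ℝⁿ → U` is locally Lipschitz with `k(0) = 0` and satisfies the (H2)
inequality `∇P(x)·f(x,k(x)) ≤ −2μ|x|²` on `{V ≤ R}`, then
`k̃(x) := (R+1 − min(R+1, max(R, V(x))))·k(x)` is globally Lipschitz, vanishes at `0`,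
coincides with `k` on `{V ≤ R}`, and consequently satisfies the same (H2) inequality
on `{V ≤ R}`. -/
theorem stmt5 {n m : ℕ}
    (U : Set (EuclideanSpace ℝ (Fin m))) (hUc : IsCompact U) (hU0 : (0 : EuclideanSpace ℝ (Fin m)) ∈ U)
    (f : EuclideanSpace ℝ (Fin n) → EuclideanSpace ℝ (Fin m) → EuclideanSpace ℝ (Fin n))
    (hf : ContDiff ℝ (⊤ : ℕ∞) (Function.uncurry f))
    (V : EuclideanSpace ℝ (Fin n) → ℝ) (hV : ContDiff ℝ 2 V) (hVnn : ∀ x, 0 ≤ V x)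
    (hVrad : ∀ M : ℝ, Bornology.IsBounded {x | V x ≤ M})
    (P : EuclideanSpace ℝ (Fin n) → ℝ) (hP : ContDiff ℝ 2 P)
    (hP0 : P 0 = 0) (hPpos : ∀ x, x ≠ 0 → 0 < P x)
    (μ R : ℝ) (hμ : 0 < μ) (hR : 0 < R)
    (k : EuclideanSpace ℝ (Fin n) → EuclideanSpace ℝ (Fin m))
    (hk_lip : LocallyLipschitz k) (hkU : ∀ x, k x ∈ U) (hk0 : k 0 = 0)
    (h2 : ∀ x, V x ≤ R → ⟪gradient P x, f x (k x)⟫ ≤ -2 * μ * ‖x‖ ^ 2)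
    (ktilde : EuclideanSpace ℝ (Fin n) → EuclideanSpace ℝ (Fin m))
    (hkt : ∀ x, ktilde x = (R + 1 - min (R + 1) (max R (V x))) • k x) :
    (∃ Ck : NNReal, LipschitzWith Ck ktilde) ∧
    ktilde 0 = 0 ∧
    (∀ x, V x ≤ R → ktilde x = k x) ∧
    (∀ x, V x ≤ R → ⟪gradient P x, f x (ktilde x)⟫ ≤ -2 * μ * ‖x‖ ^ 2) := by
  have eqOn : ∀ x, V x ≤ R → ktilde x = k x := by
    intro x hx
    rw [hkt, max_eq_left hx, min_eq_right (by linarith), add_sub_cancel_left, one_smul]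
  refine ⟨?_, by rw [hkt, hk0, smul_zero], eqOn, fun x hx => by rw [eqOn x hx]; exact h2 x hx⟩
  apply LocallyLipschitz.exists_lipschitzWith_of_hasCompactSupport
  · have hVlip : LocallyLipschitz V := (hV.of_le one_le_two).locallyLipschitz
    have hsub : LocallyLipschitz fun t : ℝ => R + 1 - t :=
      (contDiff_const.sub contDiff_id : ContDiff ℝ 1 fun t : ℝ => R + 1 - t).locallyLipschitz
    rw [funext hkt]
    exact (hsub.comp ((hVlip.const_max R).const_min (R + 1))).smul_of_real hk_lip
  · have hcompact : IsCompact {x | V x ≤ R + 1} :=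
      Metric.isCompact_of_isClosed_isBounded (isClosed_le hV.continuous continuous_const)
        (hVrad (R + 1))
    refine HasCompactSupport.intro hcompact fun x hx => ?_
    have hx' : R + 1 ≤ V x := (not_le.mp hx).le
    rw [hkt, min_eq_left (hx'.trans (le_max_right R (V x))), sub_self, zero_smul]
end

section
/- Let t₀ ∈ ℝ, T ≥ t₀, δ > 0, σ > 0 and μ, ν, κ ≥ 0 with κ·e^{σδ} < 1. Let a : [t₀−δ, T] → [0,∞) be bounded and b, c : [t₀, T] → [0,∞). If a(t) ≤ μ·b(t) + ν·c(t) + κ·sup_{t−δ≤s≤t} a(s) for all t ∈ [t₀, T], then sup_{t₀≤t≤T} e^{σt}a(t) ≤ ( μ/(1−κe^{σδ}) )·sup_{t₀≤t≤T} e^{σt}b(t) + ( ν/(1−κe^{σδ}) )·sup_{t₀≤t≤T} e^{σt}c(t) + sup_{t₀−δ≤t≤t₀} e^{σt}a(t). -/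
/-- Multiplying by an increasing exponential weight preserves boundedness above on `[l, u]`. -/
theorem bddAbove_exp_mul_image_Icc {σ l u : ℝ} {f : ℝ → ℝ} (hσ : 0 ≤ σ)
    (hf : ∀ t ∈ Set.Icc l u, 0 ≤ f t) (hbdd : BddAbove (f '' Set.Icc l u)) :
    BddAbove ((fun t => Real.exp (σ * t) * f t) '' Set.Icc l u) := by
  obtain ⟨K, hK⟩ := hbdd
  refine ⟨Real.exp (σ * u) * K, ?_⟩
  rintro _ ⟨t, ht, rfl⟩
  have hexp : Real.exp (σ * t) ≤ Real.exp (σ * u) :=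
    Real.exp_le_exp.mpr (mul_le_mul_of_nonneg_left ht.2 hσ)
  exact mul_le_mul hexp (hK ⟨t, ht, rfl⟩) (hf t ht) (Real.exp_pos _).le

theorem sSup_exp_mul_image_nonneg {σ : ℝ} {s : Set ℝ} {f : ℝ → ℝ} (hf : ∀ t ∈ s, 0 ≤ f t) :
    0 ≤ sSup ((fun t => Real.exp (σ * t) * f t) '' s) := by
  apply Real.sSup_nonneg
  rintro _ ⟨t, ht, rfl⟩
  exact mul_nonneg (Real.exp_pos _).le (hf t ht)

/-- A bound on the exponentially weighted function bounds the weighted delayed supremum, at the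
cost of the factor `exp (σ * δ)`. -/
theorem exp_mul_sSup_image_delay_le {σ δ t M : ℝ} {f : ℝ → ℝ} (hσ : 0 ≤ σ) (hδ : 0 ≤ δ)
    (hM : 0 ≤ M) (h : ∀ s ∈ Set.Icc (t - δ) t, Real.exp (σ * s) * f s ≤ M) :
    Real.exp (σ * t) * sSup (f '' Set.Icc (t - δ) t) ≤ Real.exp (σ * δ) * M := by
  rw [mul_comm, ← le_div_iff₀ (Real.exp_pos _)]
  apply csSup_le ((Set.nonempty_Icc.mpr (by linarith)).image f)
  rintro _ ⟨s, hs, rfl⟩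
  rw [le_div_iff₀ (Real.exp_pos _)]
  calc f s * Real.exp (σ * t) = Real.exp (σ * (t - s)) * (Real.exp (σ * s) * f s) := by
        rw [← mul_assoc, ← Real.exp_add]; ring_nf
    _ ≤ Real.exp (σ * (t - s)) * M := mul_le_mul_of_nonneg_left (h s hs) (Real.exp_pos _).le
    _ ≤ Real.exp (σ * δ) * M := by
        refine mul_le_mul_of_nonneg_right (Real.exp_le_exp.mpr ?_) hM
        exact mul_le_mul_of_nonneg_left (by linarith [hs.1]) hσ


/-- Small-gain estimate for functions with bounded delay: if
`a(t) ≤ μ·b(t) + ν·c(t) + κ·sup_{t−δ≤s≤t} a(s)` on `[t₀,T]` with `κ·e^{σδ} < 1`, then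
`sup_{[t₀,T]} e^{σt}a(t) ≤ (μ/(1−κe^{σδ}))·sup e^{σt}b(t) + (ν/(1−κe^{σδ}))·sup e^{σt}c(t)
  + sup_{[t₀−δ,t₀]} e^{σt}a(t)`. -/
theorem stmt7 (t₀ T δ σ μ ν κ : ℝ) (hT : t₀ ≤ T) (hδ : 0 < δ) (hσ : 0 < σ)
    (hμ : 0 ≤ μ) (hν : 0 ≤ ν) (hκ : 0 ≤ κ)
    (hκe : κ * Real.exp (σ * δ) < 1)
    (a b c : ℝ → ℝ)
    (ha_nonneg : ∀ t ∈ Set.Icc (t₀ - δ) T, 0 ≤ a t)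
    (ha_bdd : BddAbove (a '' Set.Icc (t₀ - δ) T))
    (hb_nonneg : ∀ t ∈ Set.Icc t₀ T, 0 ≤ b t)
    (hb_bdd : BddAbove (b '' Set.Icc t₀ T))
    (hc_nonneg : ∀ t ∈ Set.Icc t₀ T, 0 ≤ c t)
    (hc_bdd : BddAbove (c '' Set.Icc t₀ T))
    (hrec : ∀ t ∈ Set.Icc t₀ T,
      a t ≤ μ * b t + ν * c t + κ * sSup (a '' Set.Icc (t - δ) t)) :
    sSup ((fun t => Real.exp (σ * t) * a t) '' Set.Icc t₀ T) ≤
      (μ / (1 - κ * Real.exp (σ * δ))) *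
          sSup ((fun t => Real.exp (σ * t) * b t) '' Set.Icc t₀ T) +
        (ν / (1 - κ * Real.exp (σ * δ))) *
          sSup ((fun t => Real.exp (σ * t) * c t) '' Set.Icc t₀ T) +
        sSup ((fun t => Real.exp (σ * t) * a t) '' Set.Icc (t₀ - δ) t₀) := by
  have hA_bdd := bddAbove_exp_mul_image_Icc hσ.le (fun t ht => ha_nonneg t ⟨by linarith [ht.1], ht.2⟩)
    (ha_bdd.mono (Set.image_mono (Set.Icc_subset_Icc_left (by linarith : t₀ - δ ≤ t₀))))
  have hP_nonneg : ∀ t ∈ Set.Icc (t₀ - δ) t₀, 0 ≤ a t :=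
    fun t ht => ha_nonneg t ⟨ht.1, ht.2.trans hT⟩
  have hP_bdd := bddAbove_exp_mul_image_Icc hσ.le hP_nonneg
    (ha_bdd.mono (Set.image_mono (Set.Icc_subset_Icc_right hT)))
  have hB_bdd := bddAbove_exp_mul_image_Icc hσ.le hb_nonneg hb_bdd
  have hC_bdd := bddAbove_exp_mul_image_Icc hσ.le hc_nonneg hc_bdd
  have hP := sSup_exp_mul_image_nonneg (σ := σ) hP_nonneg
  have hB := sSup_exp_mul_image_nonneg (σ := σ) hb_nonneg
  have hC := sSup_exp_mul_image_nonneg (σ := σ) hc_nonneg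
  set A := sSup ((fun t => Real.exp (σ * t) * a t) '' Set.Icc t₀ T)
  set P := sSup ((fun t => Real.exp (σ * t) * a t) '' Set.Icc (t₀ - δ) t₀)
  set B := sSup ((fun t => Real.exp (σ * t) * b t) '' Set.Icc t₀ T)
  set C := sSup ((fun t => Real.exp (σ * t) * c t) '' Set.Icc t₀ T)
  have hgap : 0 < 1 - κ * Real.exp (σ * δ) := by linarith
  have hweighted : ∀ s ∈ Set.Icc (t₀ - δ) T, Real.exp (σ * s) * a s ≤ max A P := by
    intro s hs
    rcases le_total t₀ s with h | h
    · exact le_max_of_le_left (le_csSup hA_bdd ⟨s, ⟨h, hs.2⟩, rfl⟩)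
    · exact le_max_of_le_right (le_csSup hP_bdd ⟨s, ⟨hs.1, h⟩, rfl⟩)
  have hA : A ≤ μ * B + ν * C + κ * Real.exp (σ * δ) * max A P := by
    apply csSup_le ((Set.nonempty_Icc.mpr hT).image _)
    rintro _ ⟨t, ht, rfl⟩
    have hb : Real.exp (σ * t) * b t ≤ B := le_csSup hB_bdd ⟨t, ht, rfl⟩
    have hc : Real.exp (σ * t) * c t ≤ C := le_csSup hC_bdd ⟨t, ht, rfl⟩
    have hd := exp_mul_sSup_image_delay_le hσ.le hδ.le (le_max_of_le_right hP)
      (fun s (hs : s ∈ Set.Icc (t - δ) t) =>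
        hweighted s ⟨by linarith [hs.1, ht.1], hs.2.trans ht.2⟩)
    have hr := mul_le_mul_of_nonneg_left (hrec t ht) (Real.exp_pos (σ * t)).le
    have hb' := mul_le_mul_of_nonneg_left hb hμ
    have hc' := mul_le_mul_of_nonneg_left hc hν
    have hd' := mul_le_mul_of_nonneg_left hd hκ
    linarith
  have hinput : 0 ≤ μ / (1 - κ * Real.exp (σ * δ)) * B + ν / (1 - κ * Real.exp (σ * δ)) * C := by
    positivity
  rcases le_total A P with h | h
  · linarith
  · rw [max_eq_left h] at hA
    have hdiv : A ≤ (μ * B + ν * C) / (1 - κ * Real.exp (σ * δ)) := by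
      rw [le_div_iff₀ hgap]
      linarith
    rw [add_div, mul_div_right_comm, mul_div_right_comm] at hdiv
    linarith
end

section
/- Let K₁, K₃, μ, C > 0, t₁ ∈ ℝ, P : ℝⁿ → [0,∞), let x : [t₁,∞) → ℝⁿ and let d : [t₁,∞) → [0,∞) be measurable. Suppose K₁|x(t)|² ≤ P(x(t)) ≤ K₃|x(t)|² for all t ≥ t₁, the map t ↦ P(x(t)) is locally absolutely continuous, and (d/dt)P(x(t)) ≤ −2μ|x(t)|² + C|x(t)|·d(t) for almost every t ≥ t₁. Then for all t ≥ t₁: |x(t)| ≤ e^{−(μ/(2K₃))(t−t₁)}·√(K₃/K₁)·|x(t₁)| + (C/(2μ))·√(2K₃/K₁)·sup_{t₁≤s≤t} ( e^{−(μ/(4K₃))(t−s)}·d(s) ). -/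
open MeasureTheory

/-- Grönwall's inequality for absolutely continuous functions: an almost everywhere bound
`F' ≤ -k F` yields exponential decay. -/
theorem AbsolutelyContinuousOnInterval.le_exp_mul_of_deriv_le {F : ℝ → ℝ} {a b k : ℝ}
    (hab : a ≤ b) (hF : AbsolutelyContinuousOnInterval F a b)
    (hderiv : ∀ᵐ s ∂(volume.restrict (Set.Icc a b)), deriv F s ≤ -k * F s) :
    F b ≤ Real.exp (-k * (b - a)) * F a := by
  have hE : AbsolutelyContinuousOnInterval (fun s => Real.exp (k * s)) a b := by
    apply ContDiffOn.absolutelyContinuousOnInterval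
    fun_prop
  have hE' (s : ℝ) : deriv (fun s => Real.exp (k * s)) s = k * Real.exp (k * s) := by
    have h := ((hasDerivAt_id s).const_mul k).exp
    simpa [mul_comm] using h.deriv
  have hint := hF.integral_deriv_mul_eq_sub hE
  have hnonneg : 0 ≤ ∫ s in a..b, -(deriv F s * Real.exp (k * s) +
      F s * deriv (fun s => Real.exp (k * s)) s) := by
    apply intervalIntegral.integral_nonneg_of_ae_restrict hab
    filter_upwards [hderiv] with s hs
    simp only [Pi.zero_apply, hE']
    nlinarith [mul_le_mul_of_nonneg_right hs (Real.exp_pos (k * s)).le]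
  rw [intervalIntegral.integral_neg, hint] at hnonneg
  have hsplit : Real.exp (-k * (b - a)) = Real.exp (k * a) / Real.exp (k * b) := by
    rw [← Real.exp_sub]
    congr 1
    ring
  rw [hsplit, div_mul_eq_mul_div, le_div_iff₀ (Real.exp_pos _)]
  linarith

/-- Exponential input-to-state estimate for the plant state: if
`K₁|x(t)|² ≤ P(x(t)) ≤ K₃|x(t)|²`, `t ↦ P(x(t))` is (locally) absolutely continuous —
encoded by the integral representation `P(x(t)) = P(x(t₁)) + ∫_{t₁}^t g` with `g` locally
integrable — and `(d/dt)P(x(t)) ≤ −2μ|x(t)|² + C|x(t)|·d(t)` a.e. on `[t₁,∞)`, then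
`|x(t)| ≤ e^{−(μ/(2K₃))(t−t₁)}√(K₃/K₁)|x(t₁)| + (C/(2μ))√(2K₃/K₁)·
  sup_{t₁≤s≤t} e^{−(μ/(4K₃))(t−s)} d(s)`. -/
theorem stmt9 {n : ℕ} (K₁ K₃ μ C t₁ : ℝ)
    (hK₁ : 0 < K₁) (hK₃ : 0 < K₃) (hμ : 0 < μ) (hC : 0 < C)
    (P : EuclideanSpace ℝ (Fin n) → ℝ) (hP0 : ∀ y, 0 ≤ P y)
    (x : ℝ → EuclideanSpace ℝ (Fin n)) (d : ℝ → ℝ)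
    (hd_meas : Measurable d) (hd0 : ∀ t, t₁ ≤ t → 0 ≤ d t)
    (hd_bdd : ∀ t, t₁ ≤ t → BddAbove (d '' Set.Icc t₁ t))
    (hx_cont : ContinuousOn x (Set.Ici t₁))
    (hbound : ∀ t, t₁ ≤ t → K₁ * ‖x t‖ ^ 2 ≤ P (x t) ∧ P (x t) ≤ K₃ * ‖x t‖ ^ 2)
    (g : ℝ → ℝ)
    (hg_int : ∀ t, t₁ ≤ t → IntervalIntegrable g volume t₁ t)
    (hrep : ∀ t, t₁ ≤ t → P (x t) = P (x t₁) + ∫ s in t₁..t, g s)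
    (hineq : ∀ᵐ s ∂(volume.restrict (Set.Ici t₁)),
        g s ≤ -2 * μ * ‖x s‖ ^ 2 + C * ‖x s‖ * d s) :
    ∀ t, t₁ ≤ t →
      ‖x t‖ ≤ Real.exp (-(μ / (2 * K₃)) * (t - t₁)) * Real.sqrt (K₃ / K₁) * ‖x t₁‖ +
        (C / (2 * μ)) * Real.sqrt (2 * K₃ / K₁) *
          sSup ((fun s => Real.exp (-(μ / (4 * K₃)) * (t - s)) * d s) '' Set.Icc t₁ t) := by
  intro t ht
  set S := (fun s => Real.exp (-(μ / (4 * K₃)) * (t - s)) * d s) '' Set.Icc t₁ t with hS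
  set M := sSup S with hM
  have hS_bdd : BddAbove S := by
    obtain ⟨B, hB⟩ := hd_bdd t ht
    refine ⟨B, ?_⟩
    rintro _ ⟨s, hs, rfl⟩
    refine le_trans ?_ (hB ⟨s, hs, rfl⟩)
    apply mul_le_of_le_one_left (hd0 s hs.1)
    rw [Real.exp_le_one_iff, neg_mul, neg_nonpos]
    exact mul_nonneg (by positivity) (sub_nonneg.2 hs.2)
  have hM0 : 0 ≤ M :=
    le_trans (mul_nonneg (Real.exp_pos _).le (hd0 t ht))
      (le_csSup hS_bdd ⟨t, Set.right_mem_Icc.2 ht, rfl⟩)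
  have hd_sq (s : ℝ) (hs : s ∈ Set.Icc t₁ t) :
      d s ^ 2 ≤ M ^ 2 * Real.exp (μ / (2 * K₃) * (t - s)) := by
    have h1 : Real.exp (-(μ / (4 * K₃)) * (t - s)) * d s ≤ M := le_csSup hS_bdd ⟨s, hs, rfl⟩
    rw [neg_mul, Real.exp_neg, inv_mul_le_iff₀ (Real.exp_pos _)] at h1
    calc d s ^ 2 ≤ (Real.exp (μ / (4 * K₃) * (t - s)) * M) ^ 2 :=
          pow_le_pow_left₀ (hd0 s hs.1) h1 2
      _ = M ^ 2 * Real.exp (μ / (2 * K₃) * (t - s)) := by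
          rw [mul_pow, mul_comm, ← Real.exp_nat_mul]
          congr 2
          push_cast
          field_simp
          ring
  set L := C ^ 2 * K₃ * M ^ 2 / (2 * μ ^ 2) with hL
  have hL0 : 0 ≤ L := by positivity
  let w : ℝ → ℝ := fun s => L * Real.exp (μ / (2 * K₃) * (t - s))
  let F : ℝ → ℝ := fun s => (P (x t₁) - w s) + ∫ u in t₁..s, g u
  have hw (s : ℝ) : HasDerivAt w (-(μ / (2 * K₃)) * w s) s := by
    have h := ((((hasDerivAt_id s).const_sub t).const_mul (μ / (2 * K₃))).exp).const_mul L
    convert! h using 1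
    simp only [w, id]
    ring
  have hF_ac : AbsolutelyContinuousOnInterval F t₁ t := by
    apply AbsolutelyContinuousOnInterval.fun_add
    · apply ContDiffOn.absolutelyContinuousOnInterval
      fun_prop
    · exact (hg_int t ht).absolutelyContinuousOnInterval_intervalIntegral (by simp)
  have hF_eq (s : ℝ) (hs : t₁ ≤ s) : F s = P (x s) - w s := by
    rw [hrep s hs]
    ring
  have hF_deriv : ∀ᵐ s ∂(volume.restrict (Set.Icc t₁ t)), deriv F s ≤ -(μ / K₃) * F s := by
    filter_upwards [ae_restrict_mem measurableSet_Icc,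
      ae_restrict_of_ae (hg_int t ht).ae_hasDerivAt_integral,
      ae_restrict_of_ae_restrict_of_subset Set.Icc_subset_Ici_self hineq] with s hs hds hgs
    have hds' : HasDerivAt F (-(-(μ / (2 * K₃)) * w s) + g s) s :=
      ((hw s).const_sub _).add (hds (by rwa [Set.uIcc_of_le ht]) t₁ (by simp))
    rw [hds'.deriv, hF_eq s hs.1]
    have hyoung : C * ‖x s‖ * d s ≤ μ * ‖x s‖ ^ 2 + C ^ 2 / (4 * μ) * d s ^ 2 := by
      have h : μ * ‖x s‖ ^ 2 + C ^ 2 / (4 * μ) * d s ^ 2 - C * ‖x s‖ * d s =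
          (2 * μ * ‖x s‖ - C * d s) ^ 2 / (4 * μ) := by
        field_simp
        ring
      have : 0 ≤ (2 * μ * ‖x s‖ - C * d s) ^ 2 / (4 * μ) := by positivity
      linarith
    have hdw : C ^ 2 / (4 * μ) * d s ^ 2 ≤ μ / (2 * K₃) * w s := by
      calc _ ≤ C ^ 2 / (4 * μ) * (M ^ 2 * Real.exp (μ / (2 * K₃) * (t - s))) :=
            mul_le_mul_of_nonneg_left (hd_sq s hs) (by positivity)
        _ = μ / (2 * K₃) * w s := by
            simp only [w, hL]
            field_simp
            ring
    have hPs : μ / K₃ * P (x s) ≤ μ * ‖x s‖ ^ 2 := by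
      rw [div_mul_eq_mul_div, div_le_iff₀ hK₃]
      nlinarith [mul_le_mul_of_nonneg_left (hbound s hs.1).2 hμ.le]
    have hhalf : μ / K₃ * w s = 2 * (μ / (2 * K₃) * w s) := by
      field_simp
    linarith
  have hdecay := hF_ac.le_exp_mul_of_deriv_le ht hF_deriv
  rw [hF_eq t ht, hF_eq t₁ le_rfl] at hdecay
  have hwt : w t = L := by simp [w]
  have hw1 : 0 ≤ w t₁ := by positivity
  have hexp : Real.exp (-(μ / K₃) * (t - t₁)) =
      Real.exp (-(μ / (2 * K₃)) * (t - t₁)) ^ 2 := by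
    rw [← Real.exp_nat_mul]
    congr 1
    push_cast
    field_simp
  have hK₁x : K₁ * ‖x t‖ ^ 2 ≤
      Real.exp (-(μ / (2 * K₃)) * (t - t₁)) ^ 2 * (K₃ * ‖x t₁‖ ^ 2) + L := by
    have h := mul_le_mul_of_nonneg_left
      (show P (x t₁) - w t₁ ≤ K₃ * ‖x t₁‖ ^ 2 by linarith [(hbound t₁ le_rfl).2])
      (Real.exp_pos (-(μ / K₃) * (t - t₁))).le
    rw [← hexp]
    linarith [(hbound t ht).1]
  set e := Real.exp (-(μ / (2 * K₃)) * (t - t₁)) with he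
  have he0 : 0 < e := Real.exp_pos _
  have hA : (e * √(K₃ / K₁) * ‖x t₁‖) ^ 2 = e ^ 2 * (K₃ * ‖x t₁‖ ^ 2) / K₁ := by
    rw [mul_pow, mul_pow, Real.sq_sqrt (by positivity)]
    ring
  have hB : (C / (2 * μ) * √(2 * K₃ / K₁) * M) ^ 2 = L / K₁ := by
    rw [mul_pow, mul_pow, Real.sq_sqrt (by positivity), hL]
    field_simp
  have hA0 : 0 ≤ e * √(K₃ / K₁) * ‖x t₁‖ := by positivity
  have hB0 : 0 ≤ C / (2 * μ) * √(2 * K₃ / K₁) * M := by positivity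
  refine (sq_le_sq₀ (norm_nonneg _) (add_nonneg hA0 hB0)).1 ?_
  calc ‖x t‖ ^ 2 ≤ (e ^ 2 * (K₃ * ‖x t₁‖ ^ 2) + L) / K₁ := by
        rw [le_div_iff₀ hK₁]
        linarith
    _ = (e * √(K₃ / K₁) * ‖x t₁‖) ^ 2 + (C / (2 * μ) * √(2 * K₃ / K₁) * M) ^ 2 := by
        rw [hA, hB, add_div]
    _ ≤ _ := by nlinarith [mul_nonneg hA0 hB0]
end

section
/- Let Q ∈ ℝ^{n×n} be symmetric positive definite with operator norm |Q|, let K₂ ∈ (0,|Q|] satisfy K₂|ξ|² ≤ ξᵀQξ for all ξ ∈ ℝⁿ, let c, ω, G₂ > 0, t₀ ∈ ℝ, let ε : [t₀,∞) → ℝⁿ be locally absolutely continuous and m : [t₀,∞) → [0,∞) measurable, and suppose (d/dt)( ε(t)ᵀQε(t) ) ≤ −2cω|ε(t)|² + 2G₂|Q|·|ε(t)|·m(t) for almost every t ≥ t₀. Then for all t ≥ t₀: |ε(t)| ≤ e^{−(cω/(2|Q|))(t−t₀)}·√(|Q|/K₂)·|ε(t₀)| + √(2|Q|/K₂)·( G₂|Q|/(cω)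 )·sup_{t₀≤s≤t} ( e^{−(cω/(4|Q|))(t−s)}·m(s) ). -/
open MeasureTheory
open scoped RealInnerProductSpace

/-- An absolutely continuous function whose derivative is almost everywhere nonpositive does not
increase. -/
theorem AbsolutelyContinuousOnInterval.le_of_ae_deriv_nonpos {f : ℝ → ℝ} {a b : ℝ} (hab : a ≤ b)
    (hf : AbsolutelyContinuousOnInterval f a b)
    (hf' : ∀ᵐ x, x ∈ Set.Icc a b → deriv f x ≤ 0) : f b ≤ f a := by
  have hle : ∫ x in a..b, deriv f x ≤ ∫ _ in a..b, (0 : ℝ) :=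
    intervalIntegral.integral_mono_ae_restrict hab hf.intervalIntegrable_deriv (by simp)
      ((ae_restrict_iff' measurableSet_Icc).2 hf')
  rw [hf.integral_deriv_eq_sub, intervalIntegral.integral_zero] at hle
  linarith

/-- A Grönwall estimate for `V' ≤ -α V + B e^{(α/2)(b-s)}` on `[a, b]`, where `V` is given as the
integral of an integrable function. -/
theorem integral_le_exp_mul_add_of_ae_le {V g : ℝ → ℝ} {a b α B : ℝ} (hab : a ≤ b) (hα : 0 < α)
    (hB : 0 ≤ B) (hg : IntervalIntegrable g volume a b)
    (hV : ∀ s ∈ Set.Icc a b, V s = V a + ∫ x in a..s, g x)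
    (hle : ∀ᵐ s, s ∈ Set.Icc a b → g s ≤ -α * V s + B * Real.exp (α / 2 * (b - s))) :
    V b ≤ Real.exp (-α * (b - a)) * V a + 2 * B / α := by
  let W : ℝ → ℝ := fun s => Real.exp (α * (s - b)) * (V a + ∫ x in a..s, g x) -
    2 * B / α * Real.exp (α / 2 * (s - b))
  have hexp (β : ℝ) : AbsolutelyContinuousOnInterval (fun s => Real.exp (β * (s - b))) a b :=
    ContDiffOn.absolutelyContinuousOnInterval (by fun_prop)
  have hconst : AbsolutelyContinuousOnInterval (fun _ : ℝ => V a) a b :=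
    ContDiffOn.absolutelyContinuousOnInterval (by fun_prop)
  have hWac : AbsolutelyContinuousOnInterval W a b :=
    ((hexp α).mul (hconst.add
      (hg.absolutelyContinuousOnInterval_intervalIntegral Set.left_mem_uIcc))).sub
      ((hexp (α / 2)).const_mul (2 * B / α))
  have hW' : ∀ᵐ s, s ∈ Set.Icc a b → deriv W s ≤ 0 := by
    filter_upwards [hle, hg.ae_hasDerivAt_integral] with s hs hds hmem
    have hI := hds (by rwa [Set.uIcc_of_le hab]) a Set.left_mem_uIcc
    have hE (β : ℝ) : HasDerivAt (fun s => Real.exp (β * (s - b)))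
        (Real.exp (β * (s - b)) * β) s := by
      simpa using (((hasDerivAt_id s).sub_const b).const_mul β).exp
    have hW : HasDerivAt W _ s :=
      ((hE α).mul (hI.const_add (V a))).sub ((hE (α / 2)).const_mul (2 * B / α))
    rw [hW.deriv, ← hV s hmem]
    have hmul := mul_le_mul_of_nonneg_left (hs hmem) (Real.exp_pos (α * (s - b))).le
    have hprod : Real.exp (α * (s - b)) * Real.exp (α / 2 * (b - s)) =
        Real.exp (α / 2 * (s - b)) := by
      rw [← Real.exp_add]; ring_nf
    have hcoef : 2 * B / α * (Real.exp (α / 2 * (s - b)) * (α / 2)) =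
        B * Real.exp (α / 2 * (s - b)) := by
      field_simp
    rw [hcoef, ← hprod]
    linarith
  have hWab := hWac.le_of_ae_deriv_nonpos hab hW'
  have hWb : W b = V b - 2 * B / α := by
    simp [W, hV b ⟨hab, le_rfl⟩]
  have hWa : W a ≤ Real.exp (-α * (b - a)) * V a := by
    have hnonneg : 0 ≤ 2 * B / α * Real.exp (α / 2 * (a - b)) := by positivity
    have harg : -α * (b - a) = α * (a - b) := by ring
    simp only [W, intervalIntegral.integral_same, add_zero, harg]
    linarith
  linarith

/-- Exponential observer-error estimate (3.21): if `Q` is a symmetric positive definite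
operator on ℝⁿ with `K₂|ξ|² ≤ ⟪ξ, Qξ⟫` for all `ξ`, `K₂ ∈ (0,‖Q‖]`, `ε` is locally
absolutely continuous (the quadratic form `⟪ε, Qε⟫` is encoded by its integral
representation) and `(d/dt)⟪ε(t), Qε(t)⟫ ≤ −2cω|ε(t)|² + 2G₂‖Q‖|ε(t)|·m(t)` a.e. on
`[t₀,∞)`, then
`|ε(t)| ≤ e^{−(cω/(2‖Q‖))(t−t₀)}√(‖Q‖/K₂)|ε(t₀)| + √(2‖Q‖/K₂)(G₂‖Q‖/(cω))·
  sup_{t₀≤s≤t} e^{−(cω/(4‖Q‖))(t−s)} m(s)`. -/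
theorem stmt10 {n : ℕ}
    (Q : EuclideanSpace ℝ (Fin n) →L[ℝ] EuclideanSpace ℝ (Fin n))
    (hQsym : ∀ v w : EuclideanSpace ℝ (Fin n), ⟪Q v, w⟫ = ⟪v, Q w⟫)
    (hQpos : ∀ v : EuclideanSpace ℝ (Fin n), v ≠ 0 → 0 < ⟪v, Q v⟫)
    (K₂ c ω G₂ t₀ : ℝ) (hK₂0 : 0 < K₂) (hK₂Q : K₂ ≤ ‖Q‖)
    (hK₂ : ∀ v : EuclideanSpace ℝ (Fin n), K₂ * ‖v‖ ^ 2 ≤ ⟪v, Q v⟫)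
    (hc : 0 < c) (hω : 0 < ω) (hG₂ : 0 < G₂)
    (ε : ℝ → EuclideanSpace ℝ (Fin n)) (m : ℝ → ℝ)
    (hm_meas : Measurable m) (hm0 : ∀ t, t₀ ≤ t → 0 ≤ m t)
    (hm_bdd : ∀ t, t₀ ≤ t → BddAbove (m '' Set.Icc t₀ t))
    (hε_cont : ContinuousOn ε (Set.Ici t₀))
    (g : ℝ → ℝ)
    (hg_int : ∀ t, t₀ ≤ t → IntervalIntegrable g volume t₀ t)
    (hrep : ∀ t, t₀ ≤ t → ⟪ε t, Q (ε t)⟫ = ⟪ε t₀, Q (ε t₀)⟫ + ∫ s in t₀..t, g s)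
    (hineq : ∀ᵐ s ∂(volume.restrict (Set.Ici t₀)),
        g s ≤ -2 * c * ω * ‖ε s‖ ^ 2 + 2 * G₂ * ‖Q‖ * ‖ε s‖ * m s) :
    ∀ t, t₀ ≤ t →
      ‖ε t‖ ≤ Real.exp (-(c * ω / (2 * ‖Q‖)) * (t - t₀)) * Real.sqrt (‖Q‖ / K₂) * ‖ε t₀‖ +
        Real.sqrt (2 * ‖Q‖ / K₂) * (G₂ * ‖Q‖ / (c * ω)) *
          sSup ((fun s => Real.exp (-(c * ω / (4 * ‖Q‖)) * (t - s)) * m s) '' Set.Icc t₀ t) := by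
  intro t ht
  have hq : 0 < ‖Q‖ := hK₂0.trans_le hK₂Q
  have hcω : 0 < c * ω := mul_pos hc hω
  set q := ‖Q‖
  set F : ℝ → ℝ := fun s => Real.exp (-(c * ω / (4 * q)) * (t - s)) * m s with hF
  set S := sSup (F '' Set.Icc t₀ t)
  have hF_le : ∀ s ∈ Set.Icc t₀ t, F s ≤ S := by
    obtain ⟨M, hM⟩ := hm_bdd t ht
    refine fun s hs => le_csSup ⟨M, ?_⟩ (Set.mem_image_of_mem F hs)
    rintro _ ⟨r, hr, rfl⟩
    refine (mul_le_of_le_one_left (hm0 r hr.1) (Real.exp_le_one_iff.2 ?_)).trans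
      (hM (Set.mem_image_of_mem m hr))
    have := mul_nonneg (div_pos hcω (by positivity : 0 < 4 * q)).le (sub_nonneg.2 hr.2)
    linarith
  have hS0 : 0 ≤ S :=
    (mul_nonneg (Real.exp_pos _).le (hm0 t ht)).trans (hF_le t ⟨ht, le_rfl⟩)
  have hm_sq : ∀ s ∈ Set.Icc t₀ t, m s ^ 2 ≤ S ^ 2 * Real.exp (c * ω / q / 2 * (t - s)) := by
    intro s hs
    have hsq : F s ^ 2 ≤ S ^ 2 :=
      pow_le_pow_left₀ (mul_nonneg (Real.exp_pos _).le (hm0 s hs.1)) (hF_le s hs) 2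
    have hexp : Real.exp (-(c * ω / (4 * q)) * (t - s)) ^ 2 *
        Real.exp (c * ω / q / 2 * (t - s)) = 1 := by
      rw [← Real.exp_nat_mul, ← Real.exp_add, Real.exp_eq_one_iff]
      push_cast
      field_simp
      ring
    calc m s ^ 2 = F s ^ 2 * Real.exp (c * ω / q / 2 * (t - s)) := by
          simp only [hF, mul_pow]
          linear_combination (-(m s ^ 2)) * hexp
      _ ≤ _ := by gcongr
  have hV_le : ∀ v : EuclideanSpace ℝ (Fin n), ⟪v, Q v⟫ ≤ q * ‖v‖ ^ 2 := fun v =>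
    calc ⟪v, Q v⟫ ≤ ‖v‖ * ‖Q v‖ := real_inner_le_norm _ _
      _ ≤ ‖v‖ * (q * ‖v‖) := by gcongr; exact Q.le_opNorm v
      _ = q * ‖v‖ ^ 2 := by ring
  have hle : ∀ᵐ s, s ∈ Set.Icc t₀ t → g s ≤ -(c * ω / q) * ⟪ε s, Q (ε s)⟫ +
      (G₂ * q * S) ^ 2 / (c * ω) * Real.exp (c * ω / q / 2 * (t - s)) := by
    filter_upwards [(ae_restrict_iff' measurableSet_Ici).1 hineq] with s hs hmem
    have hdecay : c * ω / q * ⟪ε s, Q (ε s)⟫ ≤ c * ω * ‖ε s‖ ^ 2 :=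
      calc c * ω / q * ⟪ε s, Q (ε s)⟫ ≤ c * ω / q * (q * ‖ε s‖ ^ 2) := by
            gcongr; exact hV_le _
        _ = c * ω * ‖ε s‖ ^ 2 := by field_simp
    have hyoung : 2 * G₂ * q * ‖ε s‖ * m s ≤
        c * ω * ‖ε s‖ ^ 2 + (G₂ * q) ^ 2 / (c * ω) * m s ^ 2 := by
      have hsq : 0 ≤ (c * ω * ‖ε s‖ - G₂ * q * m s) ^ 2 / (c * ω) := by positivity
      have hexpand : (c * ω * ‖ε s‖ - G₂ * q * m s) ^ 2 / (c * ω) =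
          c * ω * ‖ε s‖ ^ 2 + (G₂ * q) ^ 2 / (c * ω) * m s ^ 2 -
            2 * G₂ * q * ‖ε s‖ * m s := by
        field_simp
        ring
      linarith
    have hbound : (G₂ * q) ^ 2 / (c * ω) * m s ^ 2 ≤
        (G₂ * q * S) ^ 2 / (c * ω) * Real.exp (c * ω / q / 2 * (t - s)) :=
      calc (G₂ * q) ^ 2 / (c * ω) * m s ^ 2 ≤
            (G₂ * q) ^ 2 / (c * ω) * (S ^ 2 * Real.exp (c * ω / q / 2 * (t - s))) := by
              gcongr; exact hm_sq s hmem
        _ = _ := by ring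
    linarith [hs hmem.1]
  have hVt := integral_le_exp_mul_add_of_ae_le (V := fun s => ⟪ε s, Q (ε s)⟫) ht
    (div_pos hcω hq) (by positivity) (hg_int t ht) (fun s hs => hrep s hs.1) hle
  set X := Real.exp (-(c * ω / (2 * q)) * (t - t₀)) * Real.sqrt (q / K₂) * ‖ε t₀‖ with hX
  set Y := Real.sqrt (2 * q / K₂) * (G₂ * q / (c * ω)) * S with hY
  have hX0 : 0 ≤ X := by positivity
  have hY0 : 0 ≤ Y := by positivity
  have hXsq : K₂ * X ^ 2 = Real.exp (-(c * ω / q) * (t - t₀)) * (q * ‖ε t₀‖ ^ 2) := by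
    have hexp : Real.exp (-(c * ω / (2 * q)) * (t - t₀)) ^ 2 =
        Real.exp (-(c * ω / q) * (t - t₀)) := by
      rw [← Real.exp_nat_mul]
      congr 1
      push_cast
      field_simp
    rw [hX, mul_pow, mul_pow, hexp, Real.sq_sqrt (by positivity)]
    field_simp
  have hYsq : K₂ * Y ^ 2 = 2 * ((G₂ * q * S) ^ 2 / (c * ω)) / (c * ω / q) := by
    rw [hY, mul_pow, mul_pow, Real.sq_sqrt (by positivity)]
    field_simp
  have hinit : Real.exp (-(c * ω / q) * (t - t₀)) * ⟪ε t₀, Q (ε t₀)⟫ ≤ K₂ * X ^ 2 := by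
    rw [hXsq]
    gcongr
    exact hV_le _
  have hsum : K₂ * ‖ε t‖ ^ 2 ≤ K₂ * (X ^ 2 + Y ^ 2) := by
    rw [mul_add, hYsq]
    exact (hK₂ _).trans (hVt.trans (by gcongr))
  refine (abs_le_of_sq_le_sq' ?_ (add_nonneg hX0 hY0)).2
  nlinarith [le_of_mul_le_mul_left hsum hK₂0, mul_nonneg hX0 hY0]
end

section
/- For every x = (x₁,x₂) ∈ ℝ² and every u ∈ [−4√2, 4√2]: ∇V(x)·f(x,u) ≤ 2V(x) + 16 − 2V(x)². Consequently, ∇V(x)·f(x,u) ≤ −½V(x) whenever V(x) ≥ 4; i.e., assumption (H1) holds for this system with W(x) = ½V(x) and R = 4. -/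
/-- Verification of assumption (H1) for Example 4.1: for the planar system
`f(x,u) = (g·x₁ − x₁³ + x₂, −x₂³ + u)` with `0 < g ≤ 1/167`, `V(x) = ½(x₁² + x₂²)`,
`u ∈ [−4√2, 4√2]`, one has `∇V(x)·f(x,u) ≤ 2V(x) + 16 − 2V(x)²`, and consequently
`∇V(x)·f(x,u) ≤ −½V(x)` whenever `V(x) ≥ 4` (i.e. (H1) holds with `W = V/2`, `R = 4`). -/
theorem stmt13 (g : ℝ) (hg : 0 < g) (hg' : g ≤ 1 / 167)
    (x₁ x₂ u : ℝ) (hu : u ∈ Set.Icc (-(4 * Real.sqrt 2)) (4 * Real.sqrt 2)) :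
    x₁ * (g * x₁ - x₁ ^ 3 + x₂) + x₂ * (-x₂ ^ 3 + u) ≤
      2 * ((x₁ ^ 2 + x₂ ^ 2) / 2) + 16 - 2 * ((x₁ ^ 2 + x₂ ^ 2) / 2) ^ 2 ∧
    (4 ≤ (x₁ ^ 2 + x₂ ^ 2) / 2 →
      x₁ * (g * x₁ - x₁ ^ 3 + x₂) + x₂ * (-x₂ ^ 3 + u) ≤
        -(1 / 2) * ((x₁ ^ 2 + x₂ ^ 2) / 2)) := by
  have hu2 : u ^ 2 ≤ 32 := by
    have h := sq_le_sq' hu.1 hu.2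
    rw [mul_pow, Real.sq_sqrt zero_le_two] at h
    linarith
  have hga : g * x₁ ^ 2 ≤ 1 / 167 * x₁ ^ 2 :=
    mul_le_mul_of_nonneg_right hg' (sq_nonneg x₁)
  have bound : x₁ * (g * x₁ - x₁ ^ 3 + x₂) + x₂ * (-x₂ ^ 3 + u) ≤
      2 * ((x₁ ^ 2 + x₂ ^ 2) / 2) + 16 - 2 * ((x₁ ^ 2 + x₂ ^ 2) / 2) ^ 2 := by
    linarith [sq_nonneg (x₁ ^ 2 - x₂ ^ 2), sq_nonneg (x₁ - x₂), sq_nonneg (x₂ - u),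
      sq_nonneg x₁]
  refine ⟨bound, fun hV => bound.trans ?_⟩
  generalize (x₁ ^ 2 + x₂ ^ 2) / 2 = V at hV ⊢
  nlinarith
end

section
/- For every x = (x₁,x₂) ∈ ℝ² with x₁² + x₂² ≤ 8 (i.e. V(x) ≤ 4) and every g with 0 < g ≤ 1/167: | (4g²+1)x₁ + 3g x₂ + 2g(4g²−1)x₁³ + 12g² x₂ x₁² + 6g x₂² x₁ | ≤ 4√2. -/
/-- For `V(x) = ½(x₁²+x₂²) ≤ 4` and `0 < g ≤ 1/167`, the nominal feedback of Example 4.1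
does not exceed the saturation level `4√2`. -/
theorem stmt14 (g x₁ x₂ : ℝ) (hg : 0 < g) (hg' : g ≤ 1 / 167)
    (hx : (x₁ ^ 2 + x₂ ^ 2) / 2 ≤ 4) :
    |(4 * g ^ 2 + 1) * x₁ + 3 * g * x₂ + 2 * g * (4 * g ^ 2 - 1) * x₁ ^ 3 +
        12 * g ^ 2 * x₂ * x₁ ^ 2 + 6 * g * x₂ ^ 2 * x₁| ≤ 4 * Real.sqrt 2 := by
  have h₁ : |x₁| ≤ 3 := abs_le_of_sq_le_sq (by nlinarith [sq_nonneg x₂]) (by norm_num)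
  have h₂ : |x₂| ≤ 3 := abs_le_of_sq_le_sq (by nlinarith [sq_nonneg x₁]) (by norm_num)
  have hcubic : |4 * g ^ 2 - 1| ≤ 1 := by
    rw [abs_le]
    constructor <;> nlinarith
  have hsqrt : (7 / 5 : ℝ) ≤ Real.sqrt 2 := Real.le_sqrt_of_sq_le (by norm_num)
  calc
    _ ≤ |(4 * g ^ 2 + 1) * x₁| + |3 * g * x₂| + |2 * g * (4 * g ^ 2 - 1) * x₁ ^ 3| +
          |12 * g ^ 2 * x₂ * x₁ ^ 2| + |6 * g * x₂ ^ 2 * x₁| := by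
      refine (abs_add_le _ _).trans (add_le_add_left ?_ _)
      refine (abs_add_le _ _).trans (add_le_add_left ?_ _)
      exact abs_add_three _ _ _
    _ = (4 * g ^ 2 + 1) * |x₁| + 3 * g * |x₂| + 2 * g * |4 * g ^ 2 - 1| * |x₁| ^ 3 +
          12 * g ^ 2 * |x₂| * |x₁| ^ 2 + 6 * g * |x₂| ^ 2 * |x₁| := by
      have hpos : |4 * g ^ 2 + 1| = 4 * g ^ 2 + 1 := abs_of_pos (by positivity)
      simp only [abs_mul, abs_pow, hpos, abs_of_pos hg, Nat.abs_ofNat]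
    _ ≤ (4 * (1 / 167) ^ 2 + 1) * 3 + 3 * (1 / 167) * 3 + 2 * (1 / 167) * 1 * 3 ^ 3 +
          12 * (1 / 167) ^ 2 * 3 * 3 ^ 2 + 6 * (1 / 167) * 3 ^ 2 * 3 := by
      gcongr
    _ ≤ 4 * (7 / 5) := by norm_num
    _ ≤ 4 * Real.sqrt 2 := by gcongr
end

section
/- For every g with 0 < g ≤ 1/167 and every x = (x₁,x₂) ∈ ℝ² with V(x) ≤ 4, with k(x) := −( (4g²+1)x₁ + 3g x₂ + 2g(4g²−1)x₁³ + 12g² x₂ x₁² + 6g x₂² x₁ ): ∇P(x)·f(x,k(x)) = −g x₁² − g(x₂+2g x₁)² − x₁⁴ − (x₂+2g x₁)⁴ ≤ −(g/2)(x₁² + x₂²). Moreover ¼(x₁²+x₂²) ≤ P(x) for all x ∈ ℝ². Hence assumption (H2) holds for this system with μ = g/4 and K₁ = 1/4. -/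
/-- Verification of assumption (H2) for Example 4.1: with
`f(x,u) = (g·x₁ − x₁³ + x₂, −x₂³ + u)`, `V(x) = ½(x₁²+x₂²)`,
`P(x) = ½x₁² + ½(x₂+2g·x₁)²` and the nominal feedback
`k(x) = −((4g²+1)x₁ + 3g x₂ + 2g(4g²−1)x₁³ + 12g² x₂ x₁² + 6g x₂² x₁)`,
for every `0 < g ≤ 1/167` and every `x` with `V(x) ≤ 4` one has
`∇P(x)·f(x,k(x)) = −g x₁² − g(x₂+2g x₁)² − x₁⁴ − (x₂+2g x₁)⁴ ≤ −(g/2)(x₁²+x₂²)`;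
moreover `¼(x₁²+x₂²) ≤ P(x)` for all `x`.  Hence (H2) holds with `μ = g/4`, `K₁ = 1/4`. -/
theorem stmt15 (g x₁ x₂ : ℝ) (hg : 0 < g) (hg' : g ≤ 1 / 167)
    (hV : (x₁ ^ 2 + x₂ ^ 2) / 2 ≤ 4) :
    ((x₁ + 2 * g * (x₂ + 2 * g * x₁)) * (g * x₁ - x₁ ^ 3 + x₂) +
        (x₂ + 2 * g * x₁) *
          (-x₂ ^ 3 +
            -((4 * g ^ 2 + 1) * x₁ + 3 * g * x₂ + 2 * g * (4 * g ^ 2 - 1) * x₁ ^ 3 +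
                12 * g ^ 2 * x₂ * x₁ ^ 2 + 6 * g * x₂ ^ 2 * x₁)) =
      -g * x₁ ^ 2 - g * (x₂ + 2 * g * x₁) ^ 2 - x₁ ^ 4 - (x₂ + 2 * g * x₁) ^ 4) ∧
    (-g * x₁ ^ 2 - g * (x₂ + 2 * g * x₁) ^ 2 - x₁ ^ 4 - (x₂ + 2 * g * x₁) ^ 4 ≤
      -(g / 2) * (x₁ ^ 2 + x₂ ^ 2)) ∧
    (∀ y₁ y₂ : ℝ, (1 / 4) * (y₁ ^ 2 + y₂ ^ 2) ≤ (1 / 2) * y₁ ^ 2 + (1 / 2) * (y₂ + 2 * g * y₁) ^ 2) := by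
  have hP : ∀ y₁ y₂ : ℝ,
      (1 / 4) * (y₁ ^ 2 + y₂ ^ 2) ≤ (1 / 2) * y₁ ^ 2 + (1 / 2) * (y₂ + 2 * g * y₁) ^ 2 := by
    intro y₁ y₂
    have h₁ : 0 ≤ (1 / 4 - g) * (y₁ ^ 2 + y₂ ^ 2) := mul_nonneg (by linarith) (by positivity)
    have h₂ : 0 ≤ g * (y₁ + y₂) ^ 2 := by positivity
    have h₃ : 0 ≤ 2 * (g * y₁) ^ 2 := by positivity
    linarith
  refine ⟨by ring, ?_, hP⟩
  have hPg := mul_le_mul_of_nonneg_left (hP x₁ x₂) hg.le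
  have h₁ : 0 ≤ x₁ ^ 4 := by positivity
  have h₂ : 0 ≤ (x₂ + 2 * g * x₁) ^ 4 := by positivity
  linarith
end

section
/- For every u ∈ [−4√2, 4√2], every z = (z₁,z₂) ∈ ℝ² with V(z) ≤ 7 and every x = (x₁,x₂) ∈ ℝ² with V(x) ≤ 4: (z−x)ᵀ Q ( f(z,u) + L(z₁−x₁) − f(x,u) ) ≤ −(p/4)·|z−x|². That is, assumption (H3) holds for this system with ω = p/4 and b = 7. -/
/-- Verification of assumption (H3) for Example 4.1: with
`f(x,u) = (g·x₁ − x₁³ + x₂, −x₂³ + u)` (`0 < g ≤ 1/167`), output `h(x) = x₁`,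
`Q = ½[[1,−p],[−p,1]]`, `L = (L₁,L₂)` as in the paper, for every `u ∈ [−4√2,4√2]`,
every `z` with `V(z) ≤ 7` and every `x` with `V(x) ≤ 4`:
`(z−x)ᵀ Q (f(z,u) + L(z₁−x₁) − f(x,u)) ≤ −(p/4)|z−x|²`, i.e. (H3) holds with
`ω = p/4`, `b = 7`. -/
theorem stmt17 (g p : ℝ) (hg : 0 < g) (hg' : g ≤ 1 / 167) (hp : 0 < p) (hp1 : p < 1)
    (L₁ L₂ : ℝ)
    (hL₁ : L₁ = -(2 * g + 2 * p * (1 - p * g) + 4 * p * (11 + 2 * Real.sqrt 7) ^ 2 + p) /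
        (2 * (1 - p ^ 2)))
    (hL₂ : L₂ = -(2 * g * p + 4 * p ^ 2 * (11 + 2 * Real.sqrt 7) ^ 2 + p ^ 2 + 2 * (1 - p * g)) /
        (2 * (1 - p ^ 2)))
    (u z₁ z₂ x₁ x₂ : ℝ) (hu : u ∈ Set.Icc (-(4 * Real.sqrt 2)) (4 * Real.sqrt 2))
    (hz : (z₁ ^ 2 + z₂ ^ 2) / 2 ≤ 7) (hx : (x₁ ^ 2 + x₂ ^ 2) / 2 ≤ 4)
    (F₁ F₂ : ℝ)
    (hF₁ : F₁ = (g * z₁ - z₁ ^ 3 + z₂) + L₁ * (z₁ - x₁) - (g * x₁ - x₁ ^ 3 + x₂))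
    (hF₂ : F₂ = (-z₂ ^ 3 + u) + L₂ * (z₁ - x₁) - (-x₂ ^ 3 + u)) :
    (1 / 2) * ((z₁ - x₁) * F₁ - p * (z₁ - x₁) * F₂ - p * (z₂ - x₂) * F₁ + (z₂ - x₂) * F₂) ≤
      -(p / 4) * ((z₁ - x₁) ^ 2 + (z₂ - x₂) ^ 2) := by
  have hp2 : (1 - p ^ 2) ≠ 0 := by nlinarith
  set M := 11 + 2 * Real.sqrt 7 with hM
  have h7 : Real.sqrt 7 ^ 2 = 7 := Real.sq_sqrt (by norm_num)
  have hs : 0 ≤ Real.sqrt 7 := Real.sqrt_nonneg 7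
  have hrow₁ : L₁ - p * L₂ = -(g + 2 * p * M ^ 2 + p / 2) := by
    rw [hL₁, hL₂]; field_simp; ring
  have hrow₂ : L₂ - p * L₁ = -(1 - p * g) := by
    rw [hL₁, hL₂]; field_simp; ring
  have hA : 0 ≤ z₁ ^ 2 + z₁ * x₁ + x₁ ^ 2 := by
    nlinarith [sq_nonneg (z₁ + x₁), sq_nonneg z₁, sq_nonneg x₁]
  have hB : 0 ≤ z₂ ^ 2 + z₂ * x₂ + x₂ ^ 2 := by
    nlinarith [sq_nonneg (z₂ + x₂), sq_nonneg z₂, sq_nonneg x₂]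
  have hinner : z₁ * x₁ + z₂ * x₂ ≤ 4 * Real.sqrt 7 := by
    refine le_of_abs_le (abs_le_of_sq_le_sq ?_ (by positivity))
    have hmul : (z₁ ^ 2 + z₂ ^ 2) * (x₁ ^ 2 + x₂ ^ 2) ≤ 14 * 8 :=
      mul_le_mul (by linarith) (by linarith) (by positivity) (by norm_num)
    nlinarith [sq_nonneg (z₁ * x₂ - z₂ * x₁)]
  set A := z₁ ^ 2 + z₁ * x₁ + x₁ ^ 2 with hAdef
  set B := z₂ ^ 2 + z₂ * x₂ + x₂ ^ 2 with hBdef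
  have hAB : (A + B) ^ 2 ≤ (2 * M) ^ 2 :=
    pow_le_pow_left₀ (by linarith) (by linarith) 2
  have hexpand : (z₁ - x₁) * F₁ - p * (z₁ - x₁) * F₂ - p * (z₂ - x₂) * F₁ + (z₂ - x₂) * F₂ =
      (g - A + (L₁ - p * L₂)) * (z₁ - x₁) ^ 2
        + (1 - p * g + p * (A + B) + (L₂ - p * L₁)) * ((z₁ - x₁) * (z₂ - x₂))
        - (p + B) * (z₂ - x₂) ^ 2 := by
    rw [hF₁, hF₂, hAdef, hBdef]; ring
  rw [hexpand, hrow₁, hrow₂]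
  have hcross : 0 ≤ p * ((2 * M) ^ 2 - (A + B) ^ 2) * (z₁ - x₁) ^ 2 :=
    mul_nonneg (mul_nonneg hp.le (sub_nonneg.2 hAB)) (sq_nonneg _)
  have hsquare : 0 ≤ p * ((A + B) * (z₁ - x₁) - (z₂ - x₂)) ^ 2 := by positivity
  have hAa : 0 ≤ A * (z₁ - x₁) ^ 2 := mul_nonneg hA (sq_nonneg _)
  have hBb : 0 ≤ B * (z₂ - x₂) ^ 2 := mul_nonneg hB (sq_nonneg _)
  linarith
end

section
/- Assume additionally p ≤ 1/4 and p·(597 + 176√7) ≤ 123/(4√7(√7+2)) − 2 − 2g. Then for every u ∈ [−4√2, 4√2], every z = (z₁,z₂) ∈ ℝ² with 6 < V(z) ≤ 7 and every x = (x₁,x₂) ∈ ℝ² with V(x) ≤ 4: ∇V(z)·( f(z,u) + L(z₁−x₁) ) ≤ −½V(z). -/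
/-- Verification of assumption (H4) for Example 4.1 (with `a = 6`, `b = 7`, `W = V/2`):
with `f(x,u) = (g·x₁ − x₁³ + x₂, −x₂³ + u)` (`0 < g ≤ 1/167`), output `h(x) = x₁`,
`V(x) = ½(x₁²+x₂²)` and `L = (L₁,L₂)` as in the paper, if `p ≤ 1/4` and
`p(597 + 176√7) ≤ 123/(4√7(√7+2)) − 2 − 2g`, then for every `u ∈ [−4√2,4√2]`,
every `z` with `6 < V(z) ≤ 7` and every `x` with `V(x) ≤ 4`:
`∇V(z)·( f(z,u) + L(z₁−x₁) ) ≤ −½V(z)`. -/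
theorem stmt18 (g p : ℝ) (hg : 0 < g) (hg' : g ≤ 1 / 167) (hp : 0 < p) (hp1 : p < 1)
    (hp4 : p ≤ 1 / 4)
    (hpsmall : p * (597 + 176 * Real.sqrt 7) ≤
        123 / (4 * Real.sqrt 7 * (Real.sqrt 7 + 2)) - 2 - 2 * g)
    (L₁ L₂ : ℝ)
    (hL₁ : L₁ = -(2 * g + 2 * p * (1 - p * g) + 4 * p * (11 + 2 * Real.sqrt 7) ^ 2 + p) /
        (2 * (1 - p ^ 2)))
    (hL₂ : L₂ = -(2 * g * p + 4 * p ^ 2 * (11 + 2 * Real.sqrt 7) ^ 2 + p ^ 2 + 2 * (1 - p * g)) /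
        (2 * (1 - p ^ 2)))
    (u z₁ z₂ x₁ x₂ : ℝ) (hu : u ∈ Set.Icc (-(4 * Real.sqrt 2)) (4 * Real.sqrt 2))
    (hz₁ : 6 < (z₁ ^ 2 + z₂ ^ 2) / 2) (hz₂ : (z₁ ^ 2 + z₂ ^ 2) / 2 ≤ 7)
    (hx : (x₁ ^ 2 + x₂ ^ 2) / 2 ≤ 4) :
    z₁ * ((g * z₁ - z₁ ^ 3 + z₂) + L₁ * (z₁ - x₁)) +
        z₂ * ((-z₂ ^ 3 + u) + L₂ * (z₁ - x₁)) ≤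
      -(1 / 2) * ((z₁ ^ 2 + z₂ ^ 2) / 2) := by
  set s := Real.sqrt 7
  have hs : (2.6 : ℝ) ≤ s := Real.le_sqrt_of_sq_le (by norm_num)
  have hs2 : s ^ 2 = 7 := Real.sq_sqrt (by norm_num)
  have hfrac : 123 / (4 * s * (s + 2)) ≤ 2.6 := by
    rw [div_le_iff₀ (by positivity)]
    nlinarith
  obtain ⟨q, hq⟩ : ∃ q, q = p * (597 + 176 * s) := ⟨_, rfl⟩
  have hq0 : 0 < q := by rw [hq]; positivity
  have hq1 : q ≤ 0.6 := by linarith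
  have hp2 : p ≤ 1 / 1000 := by nlinarith
  have hD : 0 < 2 * (1 - p ^ 2) := by nlinarith
  have hpg : 0 < p * g := mul_pos hp hg
  have hpg1 : p * g ≤ 1 := by nlinarith
  have hL₁' : L₁ = -((2 * g + 2 * p * (1 - p * g) + q) / (2 * (1 - p ^ 2))) := by
    rw [hL₁, hq, neg_div]
    congr 2
    linear_combination 16 * p * hs2
  have hL₂' : L₂ = -((2 + p * q) / (2 * (1 - p ^ 2))) := by
    rw [hL₂, hq, neg_div]
    congr 2
    linear_combination 16 * p ^ 2 * hs2
  have hpp : 0 ≤ p * (1 - p * g) := mul_nonneg hp.le (by linarith)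
  have hpp' : p * (1 - p * g) ≤ p := by nlinarith
  have hL₁_le : L₁ ≤ 0 := by
    rw [hL₁', neg_nonpos]
    exact div_nonneg (by linarith) hD.le
  have hL₁_ge : -1 ≤ L₁ := by
    rw [hL₁', neg_le_neg_iff, div_le_one hD]
    nlinarith
  have hL₂_le : L₂ ≤ -1 := by
    rw [hL₂', neg_le_neg_iff, one_le_div hD]
    linarith [mul_pos hp hq0, sq_nonneg p]
  have hL₂_ge : -2 ≤ L₂ := by
    rw [hL₂', neg_le_neg_iff, div_le_iff₀ hD]
    nlinarith
  have hu2 : u ^ 2 ≤ 32 := by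
    have h := sq_le_sq' hu.1 hu.2
    rw [mul_pow, Real.sq_sqrt (by norm_num)] at h
    linarith
  have hquartic : 72 ≤ z₁ ^ 4 + z₂ ^ 4 := by
    have h : (12 : ℝ) ^ 2 ≤ (z₁ ^ 2 + z₂ ^ 2) ^ 2 :=
      pow_le_pow_left₀ (by norm_num) (by linarith) 2
    linarith [sq_nonneg (z₁ ^ 2 - z₂ ^ 2)]
  have hgz : g * z₁ ^ 2 ≤ 1 := by
    linarith [mul_le_mul_of_nonneg_right hg' (sq_nonneg z₁), sq_nonneg z₂]
  have hcross : (1 + L₂) * (z₁ * z₂) ≤ 7 := by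
    have hz : 0 ≤ z₁ * z₂ + 7 := by linarith [sq_nonneg (z₁ + z₂)]
    linarith [mul_nonneg (by linarith : 0 ≤ -(1 + L₂)) hz]
  have huz : u * z₂ ≤ 23 := by
    linarith [sq_nonneg (u - z₂), sq_nonneg z₁]
  have hzx : z₂ * x₁ ≤ 11 := by
    linarith [sq_nonneg (z₂ - x₁), sq_nonneg z₁, sq_nonneg x₂]
  have hLzx : -L₂ * (z₂ * x₁) ≤ 22 := by
    linarith [mul_nonneg (by linarith : 0 ≤ -L₂) (by linarith : 0 ≤ 11 - z₂ * x₁)]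
  have hLz : L₁ * (z₁ * (z₁ - x₁)) ≤ 2 := by
    have h : 0 ≤ z₁ * (z₁ - x₁) + 2 := by
      linarith [sq_nonneg (2 * z₁ - x₁), sq_nonneg x₂]
    linarith [mul_nonneg (by linarith : 0 ≤ -L₁) h]
  linarith
end
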